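/- Let Γ be a monoid, R a commutative ring with identity, A a Γ-graded associative R-algebra, and B a Γ-algebra. Let M₁ be a Γ-graded A-submodule of a Γ-graded A-module M₂ which is superfluous in the category A-Γ-gr (for every Γ-graded submodule T of M₂, M₁ + T = M₂ implies T = M₂). Then for any B-module N that is finitely generated as an R-module, M₁ ⋉_Γ N is a superfluous Γ-graded A ⋉_Γ B-submodule of M₂ ⋉_Γ N in the category of Γ-graded A ⋉_Γ B-modules. -/

import Mathlib

open DirectSum TensorProduct

universe u

variable (Γ : Type u) [Monoid Γ] [DecidableEq Γ] (R : Type u) [CommRing R]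
  (A : Type u) [Ring A] [Algebra R A]

/-- A `Γ`-grading on the `R`-algebra `A`: an internal direct sum decomposition
`A = ⊕_{γ ∈ Γ} A_γ` into `R`-submodules with `1 ∈ A_e` and `A_γ · A_δ ⊆ A_{γδ}`. -/
structure GrAlgebra : Type (u + 1) where
  grading : Γ → Submodule R A
  internal : DirectSum.IsInternal grading
  one_mem : (1 : A) ∈ grading 1
  mul_mem : ∀ {γ δ : Γ} {a b : A},
    a ∈ grading γ → b ∈ grading δ → a * b ∈ grading (γ * δ)

variable (B : Type u) [Ring B] [Algebra R B]

/-- A `Γ`-algebra: an `R`-algebra `B` together with a right action of the monoid `Γ` on `B`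
by `R`-algebra endomorphisms, written `b ↦ b^γ = (act γ) b`. -/
structure GammaAlgebra : Type u where
  act : Γ → B →ₐ[R] B
  act_one : act 1 = AlgHom.id R B
  act_mul : ∀ γ δ : Γ, act (γ * δ) = (act δ).comp (act γ)

variable {Γ R A B}

/-- A `Γ`-graded left `A`-module: the objects of the category `A`-`Γ`-gr. -/
structure GrMod (𝒜 : GrAlgebra Γ R A) : Type (u + 1) where
  carrier : Type u
  [acg : AddCommGroup carrier]
  [modR : Module R carrier]
  [modA : Module A carrier]
  [tower : IsScalarTower R A carrier]
  grading : Γ → Submodule R carrier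
  internal : DirectSum.IsInternal grading
  smul_mem : ∀ {γ δ : Γ} {a : A} {m : carrier},
    a ∈ 𝒜.grading γ → m ∈ grading δ → a • m ∈ grading (γ * δ)

attribute [instance] GrMod.acg GrMod.modR GrMod.modA GrMod.tower

/-- Morphisms of the category `A`-`Γ`-gr. -/
structure GrHom {𝒜 : GrAlgebra Γ R A} (M N : GrMod 𝒜) where
  toLin : M.carrier →ₗ[A] N.carrier
  map_grading : ∀ γ : Γ, ∀ m ∈ M.grading γ, toLin m ∈ N.grading γ

/-- Projectivity in the category `A`-`Γ`-gr (lifting property against surjective graded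
homomorphisms). -/
def GrProjective {𝒜 : GrAlgebra Γ R A} (P : GrMod 𝒜) : Prop :=
  ∀ (M N : GrMod 𝒜) (f : GrHom M N) (g : GrHom P N),
    Function.Surjective f.toLin →
    ∃ h : GrHom P M, f.toLin.comp h.toLin = g.toLin

/-- Graded `A`-submodules of a graded module. -/
def IsGrSubmodule {𝒜 : GrAlgebra Γ R A} (M : GrMod 𝒜) (T : Submodule A M.carrier) : Prop :=
  (⨆ γ : Γ, M.grading γ ⊓ T.restrictScalars R) = T.restrictScalars R

/-- `N` is a superfluous subobject of `M` in the category `A`-`Γ`-gr. -/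
def GrSuperfluous {𝒜 : GrAlgebra Γ R A} (M : GrMod 𝒜) (N : Submodule A M.carrier) : Prop :=
  ∀ T : Submodule A M.carrier, IsGrSubmodule M T → N ⊔ T = ⊤ → T = ⊤

/-- The `B`-module `_β N`: same underlying abelian group as `N`, with the `B`-action
`b ·_β x = b^β • x`. -/
def TwistB (ρ : GammaAlgebra Γ R B) (β : Γ) (N : Type u) : Type u := N

instance (ρ : GammaAlgebra Γ R B) (β : Γ) (N : Type u) [AddCommGroup N] :
    AddCommGroup (TwistB ρ β N) := inferInstanceAs (AddCommGroup N)

instance (ρ : GammaAlgebra Γ R B) (β : Γ) (N : Type u) [AddCommGroup N] [Module R N] :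
    Module R (TwistB ρ β N) := inferInstanceAs (Module R N)

instance (ρ : GammaAlgebra Γ R B) (β : Γ) (N : Type u) [AddCommGroup N] [Module B N] :
    Module B (TwistB ρ β N) := Module.compHom N (ρ.act β).toRingHom

/-- A `Γ`-graded module over the twisted product `A ⋉_Γ B`, where the multiplication of
`A ⋉_Γ B` on the underlying `R`-module `A ⊗[R] B` is the given bilinear map `mul`.
The data is an `R`-bilinear action of `A ⊗[R] B` which is unital and multiplicative for
`mul`, together with an internal grading compatible with the grading of `A ⋉_Γ B`. -/
structure TwModStr (𝒜 : GrAlgebra Γ R A)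
    (mul : (A ⊗[R] B) →ₗ[R] (A ⊗[R] B) →ₗ[R] (A ⊗[R] B))
    (X : Type u) [AddCommGroup X] [Module R X] : Type u where
  act : (A ⊗[R] B) →ₗ[R] X →ₗ[R] X
  one_act : ∀ x : X, act ((1 : A) ⊗ₜ[R] (1 : B)) x = x
  mul_act : ∀ (p q : A ⊗[R] B) (x : X), act (mul p q) x = act p (act q x)
  grading : Γ → Submodule R X
  internal : DirectSum.IsInternal grading
  act_mem : ∀ {γ δ : Γ} {a : A} {b : B} {x : X},
    a ∈ 𝒜.grading γ → x ∈ grading δ → act (a ⊗ₜ[R] b) x ∈ grading (γ * δ)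

/-- Morphisms in the category `(A ⋉_Γ B)`-`Γ`-gr: `R`-linear, `A ⋉_Γ B`-equivariant and
degree preserving maps. -/
def IsTwHom {𝒜 : GrAlgebra Γ R A}
    {mul : (A ⊗[R] B) →ₗ[R] (A ⊗[R] B) →ₗ[R] (A ⊗[R] B)}
    {X Y : Type u} [AddCommGroup X] [Module R X] [AddCommGroup Y] [Module R Y]
    (sX : TwModStr 𝒜 mul X) (sY : TwModStr 𝒜 mul Y) (f : X →ₗ[R] Y) : Prop :=
  (∀ (p : A ⊗[R] B) (x : X), f (sX.act p x) = sY.act p (f x)) ∧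
  (∀ γ : Γ, ∀ x ∈ sX.grading γ, f x ∈ sY.grading γ)

/-- Graded `A ⋉_Γ B`-submodules: `R`-submodules stable under the action and equal to the
sum of their homogeneous components. -/
def IsTwSubmodule {𝒜 : GrAlgebra Γ R A}
    {mul : (A ⊗[R] B) →ₗ[R] (A ⊗[R] B) →ₗ[R] (A ⊗[R] B)}
    {X : Type u} [AddCommGroup X] [Module R X]
    (sX : TwModStr 𝒜 mul X) (T : Submodule R X) : Prop :=
  (∀ (p : A ⊗[R] B), ∀ x ∈ T, sX.act p x ∈ T) ∧
  (⨆ γ : Γ, sX.grading γ ⊓ T) = T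

/-- Projectivity in the category `(A ⋉_Γ B)`-`Γ`-gr (lifting property against surjective
graded homomorphisms). -/
def TwProjective {𝒜 : GrAlgebra Γ R A}
    {mul : (A ⊗[R] B) →ₗ[R] (A ⊗[R] B) →ₗ[R] (A ⊗[R] B)}
    {P : Type u} [AddCommGroup P] [Module R P] (sP : TwModStr 𝒜 mul P) : Prop :=
  ∀ (X Y : Type u) [AddCommGroup X] [Module R X] [AddCommGroup Y] [Module R Y],
    ∀ (sX : TwModStr 𝒜 mul X) (sY : TwModStr 𝒜 mul Y)
      (f : X →ₗ[R] Y) (g : P →ₗ[R] Y),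
      IsTwHom sX sY f → Function.Surjective f → IsTwHom sP sY g →
      ∃ h : P →ₗ[R] X, IsTwHom sP sX h ∧ f.comp h = g

/-- An `R`-submodule is homogeneous if it is the sum of its homogeneous components. -/
def IsHomogeneousSubmodule {ι S V : Type*} [CommRing S] [AddCommGroup V] [Module S V]
    (𝒱 : ι → Submodule S V) (T : Submodule S V) : Prop :=
  (⨆ i, 𝒱 i ⊓ T) = T

namespace IsHomogeneousSubmodule

variable {ι S V W : Type*} [CommRing S] [AddCommGroup V] [Module S V]
  [AddCommGroup W] [Module S W] {𝒱 : ι → Submodule S V} {𝒲 : ι → Submodule S W}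

theorem of_le {T : Submodule S V} (h : T ≤ ⨆ i, 𝒱 i ⊓ T) : IsHomogeneousSubmodule 𝒱 T :=
  le_antisymm (iSup_le fun _ => inf_le_right) h

theorem sup {T U : Submodule S V} (hT : IsHomogeneousSubmodule 𝒱 T)
    (hU : IsHomogeneousSubmodule 𝒱 U) : IsHomogeneousSubmodule 𝒱 (T ⊔ U) := by
  refine of_le (sup_le ?_ ?_)
  · exact hT.ge.trans (iSup_mono fun i => inf_le_inf_left _ le_sup_left)
  · exact hU.ge.trans (iSup_mono fun i => inf_le_inf_left _ le_sup_right)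

theorem map {T : Submodule S V} (hT : IsHomogeneousSubmodule 𝒱 T) (f : V →ₗ[S] W)
    (hf : ∀ i, ∀ v ∈ 𝒱 i, f v ∈ 𝒲 i) : IsHomogeneousSubmodule 𝒲 (T.map f) := by
  refine of_le ?_
  refine (Submodule.map_mono hT.ge).trans ?_
  rw [Submodule.map_iSup]
  refine iSup_mono fun i => ?_
  rintro _ ⟨v, ⟨hv, hvT⟩, rfl⟩
  exact ⟨hf i v hv, v, hvT, rfl⟩

theorem decompose_mem [DecidableEq ι] [Decomposition 𝒱] {T : Submodule S V}
    (hT : IsHomogeneousSubmodule 𝒱 T) {v : V} (hv : v ∈ T) (i : ι) :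
    (decompose 𝒱 v i : V) ∈ T := by
  have hv' : v ∈ ⨆ i, 𝒱 i ⊓ T := hT.ge hv
  induction hv' using Submodule.iSup_induction' with
  | mem j x hx =>
    rw [decompose_of_mem _ hx.1]
    by_cases hij : j = i
    · subst hij
      simpa using hx.2
    · simp [of_eq_of_ne _ _ _ (Ne.symm hij)]
  | zero => simp
  | add x y hx hy ihx ihy =>
    rw [decompose_add]
    exact T.add_mem (ihx (hT.le hx)) (ihy (hT.le hy))

theorem comap [DecidableEq ι] (h𝒱 : IsInternal 𝒱) (h𝒲 : IsInternal 𝒲) {T : Submodule S W}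
    (hT : IsHomogeneousSubmodule 𝒲 T) (f : V →ₗ[S] W)
    (hf : ∀ i, ∀ v ∈ 𝒱 i, f v ∈ 𝒲 i) : IsHomogeneousSubmodule 𝒱 (T.comap f) := by
  classical
  let _ := h𝒱.chooseDecomposition
  let _ := h𝒲.chooseDecomposition
  have hdec : ∀ v i, (decompose 𝒲 (f v) i : W) = f (decompose 𝒱 v i) := by
    intro v i
    induction v using Decomposition.inductionOn 𝒱 with
    | zero => simp
    | @homogeneous j v =>
      rw [decompose_of_mem _ (hf j v v.2), decompose_coe]
      by_cases hij : j = i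
      · subst hij
        simp
      · simp [of_eq_of_ne _ _ _ (Ne.symm hij)]
    | add x y hx hy => simp [decompose_add, hx, hy]
  refine of_le fun v hv => ?_
  rw [← sum_support_decompose 𝒱 v]
  refine Submodule.sum_mem _ fun i _ => Submodule.mem_iSup_of_mem i ⟨(decompose 𝒱 v i).2, ?_⟩
  change f _ ∈ T
  rw [← hdec]
  exact hT.decompose_mem hv i

end IsHomogeneousSubmodule

/-- If `M₁` is superfluous in `M₂`, then a finite sum of images of `M₁` under graded
equivariant maps `M₂ → V` is superfluous among the homogeneous submodules of `V` stable
under the action of `A`. -/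
theorem GrSuperfluous.biSup_map {Γ R A : Type u} [Monoid Γ] [DecidableEq Γ] [CommRing R]
    [Ring A] [Algebra R A] {𝒜 : GrAlgebra Γ R A} {M₂ : GrMod 𝒜}
    {M₁ : Submodule A M₂.carrier} (hM₁graded : IsGrSubmodule M₂ M₁)
    (hM₁ : GrSuperfluous M₂ M₁) {V ι : Type*} [AddCommGroup V] [Module R V]
    {𝒱 : Γ → Submodule R V} (h𝒱 : IsInternal 𝒱) (act : A → V →ₗ[R] V)
    (f : ι → M₂.carrier →ₗ[R] V) (hf : ∀ i γ, ∀ m ∈ M₂.grading γ, f i m ∈ 𝒱 γ)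
    (hfact : ∀ i a m, f i (a • m) = act a (f i m)) (s : Finset ι) (T : Submodule R V)
    (hTact : ∀ a, ∀ v ∈ T, act a v ∈ T) (hT : IsHomogeneousSubmodule 𝒱 T)
    (h : (⨆ i ∈ s, (M₁.restrictScalars R).map (f i)) ⊔ T = ⊤) : T = ⊤ := by
  classical
  induction s using Finset.induction_on generalizing T with
  | empty => simpa using h
  | insert i s _ ih =>
    let K : Submodule R V := (M₁.restrictScalars R).map (f i)
    have hKT : K ⊔ T = ⊤ := by
      refine ih _ ?_ ((IsHomogeneousSubmodule.map hM₁graded (f i) (hf i)).sup hT) ?_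
      · intro a v hv
        obtain ⟨_, ⟨m, hm, rfl⟩, t, ht, rfl⟩ := Submodule.mem_sup.mp hv
        rw [map_add, ← hfact]
        exact Submodule.add_mem_sup ⟨_, M₁.smul_mem a hm, rfl⟩ (hTact a t ht)
      · rw [← h, Finset.iSup_insert, ← sup_assoc, sup_comm (⨆ j ∈ s, _)]
    let T' : Submodule A M₂.carrier :=
      { (T.comap (f i)).toAddSubmonoid with
        smul_mem' := fun a m hm => by
          change f i (a • m) ∈ T
          rw [hfact]
          exact hTact a _ hm }
    have hT' : T' = ⊤ := by
      refine hM₁ T' (hT.comap M₂.internal h𝒱 (f i) (hf i)) (eq_top_iff.mpr fun m _ => ?_)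
      obtain ⟨_, ⟨m', hm', rfl⟩, t, ht, hmt⟩ :=
        Submodule.mem_sup.mp (hKT.ge (Submodule.mem_top (x := f i m)))
      refine Submodule.mem_sup.mpr ⟨m', hm', m - m', ?_, add_sub_cancel _ _⟩
      change f i (m - m') ∈ T
      rw [map_sub, ← hmt, add_sub_cancel_left]
      exact ht
    rw [← hKT, right_eq_sup]
    rintro _ ⟨m, -, rfl⟩
    exact hT'.ge (Submodule.mem_top (x := m))

/-- If `M₁` is a superfluous graded `A`-submodule of `M₂` in the category `A`-`Γ`-gr and `N`
is a `B`-module which is finitely generated over `R`, then `M₁ ⋉_Γ N` is a superfluous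
graded `A ⋉_Γ B`-submodule of `M₂ ⋉_Γ N` in the category of `Γ`-graded
`A ⋉_Γ B`-modules. -/
theorem twistedProduct_superfluous {Γ R A B : Type u} [Monoid Γ] [DecidableEq Γ] [CommRing R]
    [Ring A] [Algebra R A] [Ring B] [Algebra R B]
    (𝒜 : GrAlgebra Γ R A) (ρ : GammaAlgebra Γ R B)
    (mul : (A ⊗[R] B) →ₗ[R] (A ⊗[R] B) →ₗ[R] (A ⊗[R] B))
    (hmul : ∀ (β : Γ) (a a' : A) (b b' : B), a' ∈ 𝒜.grading β →
      mul (a ⊗ₜ[R] b) (a' ⊗ₜ[R] b') = (a * a') ⊗ₜ[R] (ρ.act β b * b'))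
    (N : Type u) [AddCommGroup N] [Module R N] [Module B N] [IsScalarTower R B N]
    [Module.Finite R N]
    (M₂ : GrMod 𝒜) (M₁ : Submodule A M₂.carrier)
    (hM₁graded : IsGrSubmodule M₂ M₁) (hM₁ : GrSuperfluous M₂ M₁)
    (sQ : TwModStr 𝒜 mul (M₂.carrier ⊗[R] N))
    (hact : ∀ (γ : Γ) (a : A) (b : B) (m : M₂.carrier) (x : N), m ∈ M₂.grading γ →
      sQ.act (a ⊗ₜ[R] b) (m ⊗ₜ[R] x) = (a • m) ⊗ₜ[R] (ρ.act γ b • x))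
    (hgr : ∀ γ : Γ, sQ.grading γ =
      LinearMap.range (TensorProduct.map (M₂.grading γ).subtype
        (LinearMap.id : N →ₗ[R] N))) :
    -- `M₁ ⋉_Γ N`, i.e. the image of `M₁ ⊗ N` in `M₂ ⋉_Γ N`, is superfluous among the
    -- graded `A ⋉_Γ B`-submodules:
    ∀ T : Submodule R (M₂.carrier ⊗[R] N), IsTwSubmodule sQ T →
      LinearMap.range (TensorProduct.map (M₁.restrictScalars R).subtype
        (LinearMap.id : N →ₗ[R] N)) ⊔ T = ⊤ → T = ⊤ := by
  rintro T ⟨hTact, hT⟩ h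
  obtain ⟨s, hs⟩ := Module.Finite.fg_top (R := R) (M := N)
  let f : N → M₂.carrier →ₗ[R] M₂.carrier ⊗[R] N := fun x => (TensorProduct.mk R _ N).flip x
  refine hM₁.biSup_map hM₁graded sQ.internal (fun a => sQ.act (a ⊗ₜ 1)) f ?_ ?_ s T
    (fun a => hTact _) hT ?_
  · intro x γ m hm
    rw [hgr]
    exact ⟨⟨m, hm⟩ ⊗ₜ x, rfl⟩
  · intro x a m
    have hm : m ∈ ⨆ γ, M₂.grading γ :=
      M₂.internal.submodule_iSup_eq_top.ge Submodule.mem_top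
    induction hm using Submodule.iSup_induction' with
    | mem γ m hm => simpa [f] using (hact γ a 1 m x hm).symm
    | zero => simp
    | add m m' _ _ hm hm' => rw [smul_add, map_add, map_add, map_add, hm, hm']
  · refine top_le_iff.mp (h.ge.trans (sup_le_sup_right ?_ T))
    rintro _ ⟨z, rfl⟩
    induction z using TensorProduct.induction_on with
    | zero => simp
    | add z w hz hw => rw [map_add]; exact Submodule.add_mem _ hz hw
    | tmul m x =>
      have hx : x ∈ Submodule.span R (s : Set N) := hs.ge Submodule.mem_top
      rw [TensorProduct.map_tmul]
      suffices Submodule.span R (s : Set N) ≤ Submodule.comap (TensorProduct.mk R _ N m.1)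
          (⨆ i ∈ s, (M₁.restrictScalars R).map (f i)) from this hx
      refine Submodule.span_le.mpr ?_
      intro y hy
      exact Submodule.mem_iSup_of_mem y (Submodule.mem_iSup_of_mem hy ⟨m.1, m.2, rfl⟩)
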